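/- arXiv:2412.10379 — 2 statements merged into one kernel-verified Lean document; each statement's English description precedes it below -/
import Mathlib

section
/- For every Tychonoff (completely regular Hausdorff) topological space X there exists a free Tychonoff Mal'tsev algebra on X: a topological Mal'tsev algebra (M, μ) whose underlying space is Tychonoff, together with a continuous map i : X → M, such that (a) the only subset of M containing i(X) and closed under μ is M itself; (b) for every topological Mal'tsev algebra (N, ν) whose underlying space is Tychonoff and every continuous map f : X → N there exists a continuous μ-homomorphism h : M → N with h ∘ i = f; and moreover (c) i is a homeomorphic embedding of X onto a closed subspace of M. -/
universe u

/-- `μ` is a continuous Mal'tsev operation on the topological space `M`. -/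
def IsContMaltsevOp {M : Type u} [TopologicalSpace M] (μ : M → M → M → M) : Prop :=
  Continuous (fun p : M × M × M => μ p.1 p.2.1 p.2.2) ∧
  (∀ x y : M, μ x y y = x) ∧ (∀ x y : M, μ y y x = x)

/-- `(M, μ, i)` is a free Tychonoff Mal'tsev algebra on the Tychonoff space `X`:
`M` is a Tychonoff topological Mal'tsev algebra generated by `i(X)`, every continuous map
from `X` to a Tychonoff topological Mal'tsev algebra extends to a continuous homomorphism
of `M`, and moreover `i` embeds `X` as a closed subspace of `M`. -/
def IsFreeTychonoffMaltsev (X : Type u) [TopologicalSpace X]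
    (M : Type u) [TopologicalSpace M] (μ : M → M → M → M) (i : X → M) : Prop :=
  T35Space M ∧ IsContMaltsevOp μ ∧ Continuous i ∧
  (∀ S : Set M, Set.range i ⊆ S → (∀ a ∈ S, ∀ b ∈ S, ∀ c ∈ S, μ a b c ∈ S) →
    S = Set.univ) ∧
  (∀ (N : Type u) [TopologicalSpace N] [T35Space N] (ν : N → N → N → N),
    IsContMaltsevOp ν →
    ∀ f : X → N, Continuous f →
      ∃ h : M → N, Continuous h ∧ (∀ a b c : M, h (μ a b c) = ν (h a) (h b) (h c)) ∧
        h ∘ i = f)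

open Filter Topology

/-! ### Separation quotients and lifts of the real line -/

theorem SeparationQuotient.continuous_out {Y : Type*} [TopologicalSpace Y] :
    Continuous (Quotient.out : SeparationQuotient Y → Y) := by
  rw [SeparationQuotient.isInducing_mk.continuous_iff]
  exact continuous_id.congr fun q => (Quotient.out_eq q).symm

theorem SeparationQuotient.isInducing_out {Y : Type*} [TopologicalSpace Y] :
    IsInducing (Quotient.out : SeparationQuotient Y → Y) := by
  refine .of_comp SeparationQuotient.continuous_out SeparationQuotient.continuous_mk ?_
  have h : (SeparationQuotient.mk ∘ Quotient.out : SeparationQuotient Y → _) = id :=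
    funext Quotient.out_eq
  exact h ▸ .id

theorem SeparationQuotient.inseparable_out_mk {Y : Type*} [TopologicalSpace Y] (y : Y) :
    Inseparable (Quotient.out (SeparationQuotient.mk y)) y :=
  SeparationQuotient.mk_eq_mk.1 (Quotient.out_eq (SeparationQuotient.mk y))

instance SeparationQuotient.instT35Space {Y : Type*} [TopologicalSpace Y]
    [CompletelyRegularSpace Y] : T35Space (SeparationQuotient Y) where
  toCompletelyRegularSpace := SeparationQuotient.isInducing_out.completelyRegularSpace

/-- Every topological abelian group is a Mal'tsev algebra under `x - y + z`. -/
theorem isContMaltsevOp_sub_add {G : Type u} [TopologicalSpace G] [AddCommGroup G]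
    [IsTopologicalAddGroup G] : IsContMaltsevOp (fun x y z : G => x - y + z) :=
  ⟨by fun_prop, fun x y => sub_add_cancel x y, fun x y => by simp⟩

/-! ### Terms in one ternary operation -/

/-- Terms over `X` in the signature with one ternary operation. -/
inductive MaltsevTerm (X : Type u) : Type u
  | of : X → MaltsevTerm X
  | op : MaltsevTerm X → MaltsevTerm X → MaltsevTerm X → MaltsevTerm X

namespace MaltsevTerm

variable {X : Type u}

/-- Evaluation of terms in an algebra `(N, ν)` under an assignment `f` of the variables. -/
def eval {N : Type u} (ν : N → N → N → N) (f : X → N) : MaltsevTerm X → N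
  | of x => f x
  | op a b c => ν (eval ν f a) (eval ν f b) (eval ν f c)

/-- The completely regular topologies on terms over `X` for which the variables and the operation
are continuous and the Mal'tsev identities hold up to inseparability. -/
structure IsAdmissible [TopologicalSpace X] (t : TopologicalSpace (MaltsevTerm X)) : Prop where
  completelyRegular : CompletelyRegularSpace (MaltsevTerm X)
  continuous_of : Continuous (of : X → MaltsevTerm X)
  continuous_op : Continuous
    (fun p : MaltsevTerm X × MaltsevTerm X × MaltsevTerm X => op p.1 p.2.1 p.2.2)
  inseparable_right : ∀ a b : MaltsevTerm X, Inseparable (op a b b) a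
  inseparable_left : ∀ a b : MaltsevTerm X, Inseparable (op b b a) a

variable [TopologicalSpace X]

theorem isAdmissible_induced_eval {N : Type u} [TopologicalSpace N] [CompletelyRegularSpace N]
    {ν : N → N → N → N} (hν : IsContMaltsevOp ν) {f : X → N} (hf : Continuous f) :
    IsAdmissible (TopologicalSpace.induced (eval (X := X) ν f) ‹_›) := by
  let := TopologicalSpace.induced (eval (X := X) ν f) ‹_›
  have hi : IsInducing (eval (X := X) ν f) := .induced _
  have hc := hi.continuous
  refine ⟨hi.completelyRegularSpace, hi.continuous_iff.2 hf, hi.continuous_iff.2 ?_, ?_, ?_⟩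
  · exact hν.1.comp (by fun_prop : Continuous
      fun p : MaltsevTerm X × MaltsevTerm X × MaltsevTerm X =>
        (eval ν f p.1, eval ν f p.2.1, eval ν f p.2.2))
  · exact fun a b => hi.inseparable_iff.1 (.of_eq (hν.2.1 _ _))
  · exact fun a b => hi.inseparable_iff.1 (.of_eq (hν.2.2 _ _))

theorem isAdmissible_sInf {T : Set (TopologicalSpace (MaltsevTerm X))}
    (hT : ∀ t ∈ T, IsAdmissible t) : IsAdmissible (sInf T) := by
  refine @IsAdmissible.mk _ _ (sInf T) ?_ ?_ ?_ ?_ ?_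
  · rw [sInf_eq_iInf']
    exact completelyRegularSpace_iInf fun t => (hT t t.2).completelyRegular
  · exact continuous_sInf_rng.2 fun t ht => (hT t ht).continuous_of
  · refine continuous_sInf_rng.2 fun t ht => ?_
    have hid : @Continuous _ _ (sInf T) t id := continuous_id_iff_le.2 (sInf_le ht)
    exact @Continuous.comp _ _ _ (_) (_) (_) _ _ (hT t ht).continuous_op
      (@Continuous.prodMap _ _ _ _ (_) (_) (_) (_) _ _ hid
        (@Continuous.prodMap _ _ _ _ (_) (_) (_) (_) _ _ hid hid))
  · intro a b
    simp only [Inseparable, nhds_sInf]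
    exact iInf_congr fun t => iInf_congr fun ht => (hT t ht).inseparable_right a b
  · intro a b
    simp only [Inseparable, nhds_sInf]
    exact iInf_congr fun t => iInf_congr fun ht => (hT t ht).inseparable_left a b

/-- The coarsest topology refining all admissible ones. -/
instance : TopologicalSpace (MaltsevTerm X) := sInf {t | IsAdmissible t}

theorem isAdmissible : IsAdmissible (inferInstance : TopologicalSpace (MaltsevTerm X)) :=
  isAdmissible_sInf fun _ ht => ht

theorem continuous_eval {N : Type u} [TopologicalSpace N] [CompletelyRegularSpace N]
    {ν : N → N → N → N} (hν : IsContMaltsevOp ν) {f : X → N} (hf : Continuous f) :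
    Continuous (eval ν f) :=
  continuous_sInf_dom (isAdmissible_induced_eval hν hf) continuous_induced_dom

/-- The operation induced on the separation quotient of the space of terms. -/
noncomputable def quotientOp (a b c : SeparationQuotient (MaltsevTerm X)) :
    SeparationQuotient (MaltsevTerm X) :=
  .mk (op a.out b.out c.out)

theorem mk_op (a b c : MaltsevTerm X) :
    SeparationQuotient.mk (op a b c) = quotientOp (.mk a) (.mk b) (.mk c) := by
  have h := SeparationQuotient.inseparable_out_mk (Y := MaltsevTerm X)
  exact (SeparationQuotient.mk_eq_mk.2
    (((h a).prod ((h b).prod (h c))).map isAdmissible.continuous_op)).symm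

theorem isContMaltsevOp_quotientOp :
    IsContMaltsevOp (quotientOp : SeparationQuotient (MaltsevTerm X) → _) := by
  have ho := SeparationQuotient.continuous_out (Y := MaltsevTerm X)
  refine ⟨SeparationQuotient.continuous_mk.comp (isAdmissible.continuous_op.comp
    (by fun_prop : Continuous fun p : SeparationQuotient (MaltsevTerm X) ×
      SeparationQuotient (MaltsevTerm X) × SeparationQuotient (MaltsevTerm X) =>
        (p.1.out, p.2.1.out, p.2.2.out))), fun x y => ?_, fun x y => ?_⟩
  · exact (SeparationQuotient.mk_eq_mk.2 (isAdmissible.inseparable_right _ _)).trans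
      (Quotient.out_eq x)
  · exact (SeparationQuotient.mk_eq_mk.2 (isAdmissible.inseparable_left _ _)).trans
      (Quotient.out_eq x)

theorem isFreeTychonoffMaltsev_separationQuotient :
    IsFreeTychonoffMaltsev X (SeparationQuotient (MaltsevTerm X)) quotientOp
      (SeparationQuotient.mk ∘ of) := by
  have := isAdmissible (X := X).completelyRegular
  refine ⟨inferInstance, isContMaltsevOp_quotientOp,
    SeparationQuotient.continuous_mk.comp isAdmissible.continuous_of, ?_, ?_⟩
  · intro S hS hop
    refine Set.eq_univ_of_forall (SeparationQuotient.forall.2 fun t => ?_)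
    induction t with
    | of x => exact hS ⟨x, rfl⟩
    | op a b c ha hb hc => exact mk_op a b c ▸ hop _ ha _ hb _ hc
  · intro N _ _ ν hν f hf
    have hc := continuous_eval hν hf
    have hmk (t : MaltsevTerm X) : eval ν f (SeparationQuotient.mk t).out = eval ν f t :=
      ((SeparationQuotient.inseparable_out_mk t).map hc).eq
    exact ⟨fun q => eval ν f q.out, hc.comp SeparationQuotient.continuous_out,
      fun a b c => hmk _, funext fun x => hmk _⟩

end MaltsevTerm

/-! ### The canonical map is a closed embedding -/

namespace IsFreeTychonoffMaltsev

variable {X M : Type u} [TopologicalSpace X] [TopologicalSpace M]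
  {μ : M → M → M → M} {i : X → M}

theorem exists_real_extension (h : IsFreeTychonoffMaltsev X M μ i) {f : X → ℝ}
    (hf : Continuous f) : ∃ g : M → ℝ, Continuous g ∧
      (∀ a b c, g (μ a b c) = g a - g b + g c) ∧ g ∘ i = f := by
  obtain ⟨g, hg, hgμ, hgi⟩ := h.2.2.2.2 (ULift.{u} ℝ) _ isContMaltsevOp_sub_add
    (fun x => ULift.up (f x)) (continuous_uliftUp.comp hf)
  exact ⟨fun m => (g m).down, continuous_uliftDown.comp hg,
    fun a b c => congrArg ULift.down (hgμ a b c),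
    funext fun x => congrArg ULift.down (congrFun hgi x)⟩

theorem isEmbedding [T35Space X] (h : IsFreeTychonoffMaltsev X M μ i) : IsEmbedding i := by
  have hind : IsInducing i := by
    refine isInducing_iff_nhds.2 fun x => le_antisymm h.2.2.1.continuousAt.le_comap ?_
    intro U hU
    obtain ⟨V, hVU, hV, hxV⟩ := mem_nhds_iff.1 hU
    obtain ⟨f, hf, hfx, hfV⟩ := CompletelyRegularSpace.completely_regular_isOpen x V hV hxV
    obtain ⟨g, hg, -, hgi⟩ := h.exists_real_extension (continuous_subtype_val.comp hf)
    have hgi (y : X) : g (i y) = f y := congrFun hgi y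
    refine ⟨g ⁻¹' Set.Iio 1, (isOpen_Iio.preimage hg).mem_nhds ?_, fun y hy => hVU ?_⟩
    · simp [hgi, hfx]
    · by_contra hyV
      simp [hgi, hfV hyV] at hy
  exact hind.isEmbedding

/-- Every element has a finite support: a homomorphism to the reals that vanishes on it vanishes
at the element. -/
theorem exists_finset_support (h : IsFreeTychonoffMaltsev X M μ i) (m : M) :
    ∃ F : Finset X, ∀ g : M → ℝ, (∀ a b c, g (μ a b c) = g a - g b + g c) →
      (∀ x ∈ F, g (i x) = 0) → g m = 0 := by
  classical
  refine Set.eq_univ_iff_forall.1 (h.2.2.2.1 {m | ∃ F : Finset X, ∀ g : M → ℝ,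
    (∀ a b c, g (μ a b c) = g a - g b + g c) → (∀ x ∈ F, g (i x) = 0) → g m = 0} ?_ ?_) m
  · rintro _ ⟨x, rfl⟩
    exact ⟨{x}, fun g _ hg => hg x (by simp)⟩
  · rintro a ⟨A, hA⟩ b ⟨B, hB⟩ c ⟨C, hC⟩
    refine ⟨A ∪ B ∪ C, fun g hgμ hg => ?_⟩
    rw [hgμ, hA g hgμ fun x hx => hg x (by simp [hx]), hB g hgμ fun x hx => hg x (by simp [hx]),
      hC g hgμ fun x hx => hg x (by simp [hx])]
    simp

theorem isClosed_range [T35Space X] (h : IsFreeTychonoffMaltsev X M μ i) :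
    IsClosed (Set.range i) := by
  have := h.1
  refine isClosed_of_closure_subset fun m hm => ?_
  obtain ⟨F, hF⟩ := h.exists_finset_support m
  have : (comap i (𝓝 m)).NeBot := comap_neBot_iff.2 fun t ht => by
    obtain ⟨_, hit, x, rfl⟩ := mem_closure_iff_nhds.1 hm t ht
    exact ⟨x, hit⟩
  let U := Ultrafilter.of (comap i (𝓝 m))
  have hU : Tendsto i U (𝓝 m) := tendsto_iff_comap.2 (Ultrafilter.of_le _)
  suffices hconv : ∃ x ∈ F, (U : Filter X) ≤ 𝓝 x by
    obtain ⟨x, -, hx⟩ := hconv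
    exact ⟨x, tendsto_nhds_unique ((h.2.2.1.tendsto x).mono_left hx) hU⟩
  by_contra! hlim
  have hsep (x : X) (hx : x ∈ F) :
      ∃ f : X → ℝ, Continuous f ∧ f x = 0 ∧ ∀ᶠ y in (U : Filter X), f y = 1 := by
    obtain ⟨V, hV, hVU⟩ := Filter.not_le.1 (hlim x hx)
    obtain ⟨W, hWV, hW, hxW⟩ := mem_nhds_iff.1 hV
    obtain ⟨f, hf, hfx, hfW⟩ := CompletelyRegularSpace.completely_regular_isOpen x W hW hxW
    refine ⟨fun y => f y, continuous_subtype_val.comp hf, by simp [hfx], ?_⟩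
    have : Wᶜ ∈ U := Ultrafilter.compl_mem_iff_notMem.2 fun hWU => hVU (mem_of_superset hWU hWV)
    filter_upwards [this] with y hy
    simp [hfW hy]
  choose! f hf hf0 hf1 using hsep
  obtain ⟨g, hg, hgμ, hgi⟩ := h.exists_real_extension (continuous_finsetProd F hf)
  have hgi (y : X) : g (i y) = ∏ x ∈ F, f x y := by simpa using congrFun hgi y
  have hgm : g m = 0 := hF g hgμ fun x hx => by
    rw [hgi]
    exact Finset.prod_eq_zero hx (hf0 x hx)
  have hg1 : ∀ᶠ y in (U : Filter X), g (i y) = 1 := by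
    filter_upwards [(eventually_all_finset F).2 hf1] with y hy
    rw [hgi]
    exact Finset.prod_eq_one hy
  have hlim0 : Tendsto (fun y => g (i y)) U (𝓝 0) := hgm ▸ (hg.tendsto m).comp hU
  exact zero_ne_one (tendsto_nhds_unique hlim0 (tendsto_nhds_of_eventually_eq hg1))

theorem isClosedEmbedding [T35Space X] (h : IsFreeTychonoffMaltsev X M μ i) :
    IsClosedEmbedding i :=
  ⟨h.isEmbedding, h.isClosed_range⟩

end IsFreeTychonoffMaltsev

/-- Theorem 2(1)–(3): for every Tychonoff space `X` there exists a free Tychonoff Mal'tsev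
algebra on `X`, and its canonical map `i` is a closed embedding. -/
theorem free_tychonoff_maltsev_exists (X : Type u) [TopologicalSpace X] [T35Space X] :
    ∃ (M : Type u) (tM : TopologicalSpace M) (μ : M → M → M → M) (i : X → M),
      @IsFreeTychonoffMaltsev X _ M tM μ i ∧ @Topology.IsClosedEmbedding X M _ tM i := by
  have h := MaltsevTerm.isFreeTychonoffMaltsev_separationQuotient (X := X)
  exact ⟨_, inferInstance, _, _, h, h.isClosedEmbedding⟩
end

section
/- Let X be a Tychonoff space, let (M, μ, i) be a free Tychonoff Mal'tsev algebra on X (identify X with i(X)), let (N, ν) be a topological Mal'tsev algebra whose underlying space is Tychonoff, and let f : X → N be a continuous quotient map (i.e. f is surjective and N carries the quotient topology induced by f). Then the continuous μ-homomorphism h : M → N extending f (h ∘ i = f) is a quotient map, and moreover h is open. -/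
universe u

/-- A quotient homomorphism of topological Mal'tsev algebras is open: near a point `y` with
`h y = h u`, the map `z ↦ μ z y u` lands in a given open neighbourhood of `u` and preserves
the value of `h`. -/
theorem IsContMaltsevOp.isOpenMap_of_isQuotientMap {M N : Type*} [TopologicalSpace M]
    [TopologicalSpace N] {μ : M → M → M → M} {ν : N → N → N → N}
    (hμ : IsContMaltsevOp μ) (hν : IsContMaltsevOp ν) {h : M → N}
    (hq : Topology.IsQuotientMap h)
    (hom : ∀ a b c : M, h (μ a b c) = ν (h a) (h b) (h c)) : IsOpenMap h := by
  intro U hU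
  rw [← hq.isOpen_preimage, isOpen_iff_mem_nhds]
  rintro y ⟨u, hu, huy⟩
  have hcont : Continuous fun z : M => μ z y u :=
    hμ.1.comp (f := fun z : M => (z, y, u)) (by fun_prop)
  have hmem : μ y y u ∈ U := by rwa [hμ.2.2]
  filter_upwards [(hU.preimage hcont).mem_nhds hmem] with z hz
  exact ⟨μ z y u, hz, by rw [hom, huy, hν.2.1]⟩

/-- Theorem 2(5): any quotient map from a Tychonoff space `X` onto a Tychonoff topological
Mal'tsev algebra `N` extends to a quotient (moreover, open) homomorphism of the free
Tychonoff Mal'tsev algebra `M(X)` onto `N`. -/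
theorem free_tychonoff_maltsev_quotient_extension
    (X : Type u) [TopologicalSpace X] [T35Space X]
    (M : Type u) [TopologicalSpace M] (μ : M → M → M → M) (i : X → M)
    (hfree : IsFreeTychonoffMaltsev X M μ i)
    (N : Type u) [TopologicalSpace N] [T35Space N] (ν : N → N → N → N)
    (hν : IsContMaltsevOp ν)
    (f : X → N) (hf : Topology.IsQuotientMap f) :
    ∀ h : M → N, Continuous h →
      (∀ a b c : M, h (μ a b c) = ν (h a) (h b) (h c)) → h ∘ i = f →
      Topology.IsQuotientMap h ∧ IsOpenMap h := by
  intro h hc hom hi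
  have hq : Topology.IsQuotientMap h :=
    Topology.IsQuotientMap.of_comp hfree.2.2.1 hc (hi ▸ hf)
  exact ⟨hq, hfree.2.1.isOpenMap_of_isQuotientMap hν hq hom⟩
end
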